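/- arXiv:1604.06170 — 4 statements merged into one kernel-verified Lean document; each statement's English description precedes it below -/
import Mathlib

section
/- Let ψ_1, …, ψ_n be vectors in ℝ^k, let ψ̄ = (1/n)∑_{j=1}^n ψ_j, let a > 0, and set ψ_{n+1} = −a·ψ̄. Then the weights p_j = a/(n(1+a)) for 1 ≤ j ≤ n and p_{n+1} = 1/(1+a) are strictly positive, sum to 1, and satisfy ∑_{j=1}^{n+1} p_j ψ_j = 0. In particular, the zero vector always lies in the convex hull of the adjusted set {ψ_1, …, ψ_n, ψ_{n+1}}, so the adjusted empirical likelihood maximization problem always has a feasible point. -/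
open Finset

/-- Given vectors `ψ 1, …, ψ n` in `ℝ^k`, their mean `ψ̄`, a constant `a > 0`,
and the pseudo-observation `ψ (n+1) = -a • ψ̄` appended via `Fin.snoc`, the weights
`p j = a / (n (1+a))` for `j ≤ n` and `p (n+1) = 1 / (1+a)` are strictly positive, sum to one,
and satisfy `∑ p j • ψ j = 0`; in particular `0` lies in the convex hull of the adjusted set,
so the adjusted empirical likelihood maximization always has a feasible point. -/
theorem adjusted_EL_feasible (k n : ℕ) (hn : 0 < n)
    (ψ : Fin n → EuclideanSpace ℝ (Fin k)) (a : ℝ) (ha : 0 < a)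
    (ψbar : EuclideanSpace ℝ (Fin k)) (hbar : ψbar = (n : ℝ)⁻¹ • ∑ j, ψ j)
    (ψext : Fin (n + 1) → EuclideanSpace ℝ (Fin k))
    (hext : ψext = Fin.snoc ψ (-(a • ψbar)))
    (p : Fin (n + 1) → ℝ)
    (hp : p = Fin.snoc (fun _ : Fin n => a / (n * (1 + a))) (1 / (1 + a))) :
    (∀ j, 0 < p j) ∧ (∑ j, p j = 1) ∧ (∑ j, p j • ψext j = 0) ∧
      (0 : EuclideanSpace ℝ (Fin k)) ∈ convexHull ℝ (Set.range ψext) := by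
  have hn' : (0 : ℝ) < n := Nat.cast_pos.mpr hn
  have hcast : ∀ j : Fin n, p j.castSucc = a / (n * (1 + a)) := fun j => by
    rw [hp, Fin.snoc_castSucc]
  have hlast : p (Fin.last n) = 1 / (1 + a) := by rw [hp, Fin.snoc_last]
  have hpos : ∀ j, 0 < p j := by
    intro j
    refine Fin.lastCases ?_ (fun j => ?_) j
    · rw [hlast]; positivity
    · rw [hcast]; positivity
  have hsum : ∑ j, p j = 1 := by
    simp only [Fin.sum_univ_castSucc, hcast, hlast, sum_const, card_univ, Fintype.card_fin,
      nsmul_eq_mul]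
    field_simp
    ring
  have hzero : ∑ j, p j • ψext j = 0 := by
    simp only [Fin.sum_univ_castSucc, hcast, hlast, hext, Fin.snoc_castSucc, Fin.snoc_last,
      ← smul_sum, hbar, smul_neg, smul_smul]
    rw [← sub_eq_add_neg, ← sub_smul]
    convert zero_smul ℝ (∑ j, ψ j) using 2
    field_simp
    ring
  refine ⟨hpos, hsum, hzero, ?_⟩
  rw [← hzero]
  exact (convex_convexHull ℝ _).sum_mem (fun j _ => (hpos j).le) hsum
    fun j _ => subset_convexHull ℝ _ (Set.mem_range_self j)
end

section
/- Let ψ_1, …, ψ_m be vectors in ℝ^k and suppose ξ ∈ ℝ^k satisfies 1 + ⟨ξ, ψ_j⟩ > 0 for all j = 1, …, m and ∑_{j=1}^m ψ_j/(1 + ⟨ξ, ψ_j⟩) = 0, and set p_j = [m(1 + ⟨ξ, ψ_j⟩)]^{-1}. Then for every q ∈ ℝ^m with q_j ≥ 0 for all j, ∑_{j=1}^m q_j = 1, and ∑_{j=1}^m q_j ψ_j = 0, one has ∏_{j=1}^m m·q_j ≤ ∏_{j=1}^m m·p_j = ∏_{j=1}^m (1 + ⟨ξ, ψ_j⟩)^{-1}.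 Consequently the supremum of ∏_{j=1}^m m·q_j over feasible q equals ∏_{j=1}^m (1 + ⟨ξ, ψ_j⟩)^{-1}, so the empirical log-likelihood-ratio statistic equals W = 2∑_{j=1}^m log(1 + ⟨ξ, ψ_j⟩). -/
open Finset RealInnerProductSpace

/-- Nonnegative reals whose sum is their number have product at most one. -/
theorem prod_le_one_of_sum_eq_card {ι : Type*} [Fintype ι] {x : ι → ℝ}
    (hx : ∀ i, 0 ≤ x i) (hsum : ∑ i, x i = Fintype.card ι) : ∏ i, x i ≤ 1 := by
  calc ∏ i, x i ≤ ∏ i, Real.exp (x i - 1) :=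
        Finset.prod_le_prod (fun i _ => hx i)
          (fun i _ => by linarith [Real.add_one_le_exp (x i - 1)])
    _ = 1 := by
        rw [← Real.exp_sum, Finset.sum_sub_distrib, hsum]
        simp

/-- If the `w`-weighted sum of the vectors `ψ i` vanishes, so does the weighted sum of `⟪ξ, ψ i⟫`. -/
theorem sum_mul_inner_eq_zero {ι E : Type*} [Fintype ι] [NormedAddCommGroup E]
    [InnerProductSpace ℝ E] {ψ : ι → E} {w : ι → ℝ} (h : ∑ i, w i • ψ i = 0) (ξ : E) :
    ∑ i, w i * ⟪ξ, ψ i⟫ = 0 := by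
  simpa [inner_sum, inner_smul_right] using congrArg (fun v => ⟪ξ, v⟫) h

/-- If `ξ` is a Lagrange multiplier for the empirical likelihood problem and
`p j = (m (1 + ⟪ξ, ψ j⟫))⁻¹` are the associated weights, then every feasible probability vector
`q` (nonnegative, summing to one, with `∑ q j • ψ j = 0`) satisfies
`∏ j, m * q j ≤ ∏ j, m * p j = ∏ j, (1 + ⟪ξ, ψ j⟫)⁻¹`; consequently the supremum of
`∏ j, m * q j` over feasible `q` equals `∏ j, (1 + ⟪ξ, ψ j⟫)⁻¹`, and the empirical
log-likelihood-ratio statistic is `W = -2 log R = 2 ∑ j, log (1 + ⟪ξ, ψ j⟫)`. -/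
theorem EL_lagrange_optimality (k m : ℕ) (hm : 0 < m)
    (ψ : Fin m → EuclideanSpace ℝ (Fin k)) (ξ : EuclideanSpace ℝ (Fin k))
    (hpos : ∀ j, 0 < 1 + ⟪ξ, ψ j⟫)
    (heq : ∑ j, (1 + ⟪ξ, ψ j⟫)⁻¹ • ψ j = 0)
    (p : Fin m → ℝ) (hp : ∀ j, p j = ((m : ℝ) * (1 + ⟪ξ, ψ j⟫))⁻¹) :
    (∀ q : Fin m → ℝ, (∀ j, 0 ≤ q j) → (∑ j, q j = 1) → (∑ j, q j • ψ j = 0) →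
        (∏ j, (m : ℝ) * q j) ≤ ∏ j, (m : ℝ) * p j) ∧
      (∏ j, (m : ℝ) * p j = ∏ j, (1 + ⟪ξ, ψ j⟫)⁻¹) ∧
      (sSup {r : ℝ | ∃ q : Fin m → ℝ, (∀ j, 0 ≤ q j) ∧ (∑ j, q j = 1) ∧
          (∑ j, q j • ψ j = 0) ∧ r = ∏ j, (m : ℝ) * q j}
        = ∏ j, (1 + ⟪ξ, ψ j⟫)⁻¹) ∧
      (-2 * Real.log (∏ j, (1 + ⟪ξ, ψ j⟫)⁻¹) = 2 * ∑ j, Real.log (1 + ⟪ξ, ψ j⟫)) := by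
  have hm' : (m : ℝ) ≠ 0 := by positivity
  have hprod : ∏ j, (m : ℝ) * p j = ∏ j, (1 + ⟪ξ, ψ j⟫)⁻¹ := by
    refine Finset.prod_congr rfl fun j _ => ?_
    rw [hp, mul_inv, mul_inv_cancel_left₀ hm']
  have hle : ∀ q : Fin m → ℝ, (∀ j, 0 ≤ q j) → (∑ j, q j = 1) → (∑ j, q j • ψ j = 0) →
      (∏ j, (m : ℝ) * q j) ≤ ∏ j, (m : ℝ) * p j := by
    intro q hq hq1 hq0
    have hone : ∏ j, (m : ℝ) * q j * (1 + ⟪ξ, ψ j⟫) ≤ 1 := by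
      refine prod_le_one_of_sum_eq_card
        (fun j => mul_nonneg (mul_nonneg m.cast_nonneg (hq j)) (hpos j).le) ?_
      simp_rw [mul_assoc, ← Finset.mul_sum, mul_add, Finset.sum_add_distrib]
      rw [sum_mul_inner_eq_zero hq0]
      simp [hq1]
    rw [Finset.prod_mul_distrib] at hone
    rw [hprod, Finset.prod_inv_distrib, ← one_div,
      le_div_iff₀ (Finset.prod_pos fun j _ => hpos j)]
    exact hone
  have hp_nonneg : ∀ j, 0 ≤ p j := fun j => by
    rw [hp]
    exact inv_nonneg.mpr (mul_nonneg m.cast_nonneg (hpos j).le)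
  have hp_sum : ∑ j, p j = 1 := by
    have hinv : ∀ j, (1 + ⟪ξ, ψ j⟫)⁻¹ = 1 - (1 + ⟪ξ, ψ j⟫)⁻¹ * ⟪ξ, ψ j⟫ := fun j => by
      have := (hpos j).ne'
      field_simp
      ring
    have hsum : ∑ j, (1 + ⟪ξ, ψ j⟫)⁻¹ = (m : ℝ) := by
      rw [Finset.sum_congr rfl fun j _ => hinv j, Finset.sum_sub_distrib,
        sum_mul_inner_eq_zero heq]
      simp
    simp_rw [hp, mul_inv]
    rw [← Finset.mul_sum, hsum, inv_mul_cancel₀ hm']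
  have hp_mean : ∑ j, p j • ψ j = 0 := by
    simp_rw [hp, mul_inv, mul_smul]
    rw [← Finset.smul_sum, heq, smul_zero]
  refine ⟨hle, hprod, ?_, ?_⟩
  · rw [← hprod]
    refine IsGreatest.csSup_eq ⟨⟨p, hp_nonneg, hp_sum, hp_mean, rfl⟩, ?_⟩
    rintro r ⟨q, hq, hq1, hq0, rfl⟩
    exact hle q hq hq1 hq0
  · rw [Finset.prod_inv_distrib, Real.log_inv, Real.log_prod fun j _ => (hpos j).ne']
    ring
end

section
/- Let ψ_1, …, ψ_m be vectors in ℝ^k such that the zero vector is an interior point of the convex hull of {ψ_1, …, ψ_m}. Then there exists ξ ∈ ℝ^k with 1 + ⟨ξ, ψ_j⟩ > 0 for all j = 1, …, m and ∑_{j=1}^m ψ_j/(1 + ⟨ξ, ψ_j⟩) = 0. That is, the Lagrange multiplier equation arising in the empirical likelihood maximization has a solution whenever 0 is interior to the convex hull of the estimating function values. -/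
open Finset RealInnerProductSpace

section

variable {E ι : Type*} [NormedAddCommGroup E] [InnerProductSpace ℝ E]

/-- If `0` is interior to the convex hull of the family `ψ`, then the polyhedron
`{ξ | ∀ j, 0 ≤ 1 + ⟪ξ, ψ j⟫}` is bounded. -/
lemma exists_norm_le_of_zero_mem_interior_convexHull {ψ : ι → E}
    (h0 : (0 : E) ∈ interior (convexHull ℝ (Set.range ψ))) :
    ∃ R : ℝ, ∀ ξ : E, (∀ j, 0 ≤ 1 + ⟪ξ, ψ j⟫) → ‖ξ‖ ≤ R := by
  obtain ⟨r, hr, hball⟩ := Metric.nhds_basis_closedBall.mem_iff.1 (mem_interior_iff_mem_nhds.1 h0)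
  refine ⟨r⁻¹, fun ξ hξ => ?_⟩
  rcases eq_or_ne ξ 0 with rfl | hne
  · simpa using hr.le
  have hpos : 0 < ‖ξ‖ := norm_pos_iff.2 hne
  have hsub : convexHull ℝ (Set.range ψ) ⊆ {x | -1 ≤ ⟪ξ, x⟫} := by
    refine convexHull_min ?_ (convex_halfSpace_ge (innerₗ E ξ).isLinear (-1))
    rintro _ ⟨j, rfl⟩
    have := hξ j
    simp only [Set.mem_ofPred_eq]
    linarith
  have hmem : -(r / ‖ξ‖) • ξ ∈ Metric.closedBall (0 : E) r := by
    rw [mem_closedBall_zero_iff, norm_smul, norm_neg, Real.norm_of_nonneg (by positivity),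
      div_mul_cancel₀ _ hpos.ne']
  have hle : -1 ≤ ⟪ξ, -(r / ‖ξ‖) • ξ⟫ := hsub (hball hmem)
  rw [real_inner_smul_right, real_inner_self_eq_norm_sq] at hle
  have heq : -(r / ‖ξ‖) * ‖ξ‖ ^ 2 = -(r * ‖ξ‖) := by field_simp
  rw [le_inv_comm₀ hpos hr, ← one_div, le_div_iff₀ hpos]
  linarith

variable [Fintype ι]

/-- A local maximizer of `ξ ↦ ∏ j, (1 + ⟪ξ, ψ j⟫)` at which all factors are positive solves the
Lagrange multiplier equation. -/
lemma sum_inv_smul_eq_zero_of_isLocalMax {ψ : ι → E} {ξ : E}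
    (hpos : ∀ j, 0 < 1 + ⟪ξ, ψ j⟫)
    (hmax : IsLocalMax (fun η : E => ∏ j, (1 + ⟪η, ψ j⟫)) ξ) :
    ∑ j, (1 + ⟪ξ, ψ j⟫)⁻¹ • ψ j = 0 := by
  classical
  set v := ∑ j, (1 + ⟪ξ, ψ j⟫)⁻¹ • ψ j with hv
  have hline : ∀ j, HasDerivAt (fun t : ℝ => 1 + ⟪ξ + t • v, ψ j⟫) ⟪v, ψ j⟫ 0 := fun j => by
    simp only [inner_add_left, real_inner_smul_left]
    simpa using (((hasDerivAt_id (0 : ℝ)).mul_const ⟪v, ψ j⟫).const_add ⟪ξ, ψ j⟫).const_add 1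
  have hderiv := HasDerivAt.fun_finsetProd (u := univ) fun j _ => hline j
  have hmax_line : IsLocalMax (fun t : ℝ => ∏ j, (1 + ⟪ξ + t • v, ψ j⟫)) 0 := by
    have hcont : ContinuousAt (fun t : ℝ => ξ + t • v) 0 := by fun_prop
    refine IsLocalMax.comp_continuous (f := fun η : E => ∏ j, (1 + ⟪η, ψ j⟫)) ?_ hcont
    simpa using hmax
  have hzero := hmax_line.hasDerivAt_eq_zero hderiv
  simp only [zero_smul, add_zero, smul_eq_mul] at hzero
  have hfactor : ∑ i, (∏ j ∈ univ.erase i, (1 + ⟪ξ, ψ j⟫)) * ⟪v, ψ i⟫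
      = (∏ j, (1 + ⟪ξ, ψ j⟫)) * ⟪v, v⟫ := by
    conv_rhs => rw [hv, inner_sum, mul_sum]
    refine sum_congr rfl fun i _ => ?_
    rw [← hv, real_inner_smul_right, ← mul_prod_erase univ _ (mem_univ i)]
    field_simp [(hpos i).ne']
  rw [hfactor, mul_eq_zero, inner_self_eq_zero] at hzero
  exact hzero.resolve_left (ne_of_gt (prod_pos fun j _ => hpos j))

/-- Existence of the empirical likelihood Lagrange multiplier in a finite-dimensional inner
product space. -/
theorem exists_lagrange_multiplier_of_zero_mem_interior_convexHull [FiniteDimensional ℝ E]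
    {ψ : ι → E} (h0 : (0 : E) ∈ interior (convexHull ℝ (Set.range ψ))) :
    ∃ ξ : E, (∀ j, 0 < 1 + ⟪ξ, ψ j⟫) ∧ ∑ j, (1 + ⟪ξ, ψ j⟫)⁻¹ • ψ j = 0 := by
  let S : Set E := {ξ | ∀ j, 0 ≤ 1 + ⟪ξ, ψ j⟫}
  obtain ⟨R, hR⟩ := exists_norm_le_of_zero_mem_interior_convexHull h0
  have hclosed : IsClosed S := by
    simp only [S, Set.ofPred_forall]
    exact isClosed_iInter fun j => isClosed_le (by fun_prop) (by fun_prop)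
  have : ProperSpace E := FiniteDimensional.proper_real E
  have hcompact : IsCompact S :=
    (isCompact_closedBall (0 : E) R).of_isClosed_subset hclosed fun ξ hξ => by
      simpa using hR ξ hξ
  have h0S : (0 : E) ∈ S := fun j => by simp
  obtain ⟨ξ, hξS, hmax⟩ := hcompact.exists_isMaxOn (f := fun η : E => ∏ j, (1 + ⟪η, ψ j⟫))
    ⟨0, h0S⟩ (by fun_prop)
  have hone : 1 ≤ ∏ j, (1 + ⟪ξ, ψ j⟫) := by simpa using hmax h0S
  have hpos : ∀ j, 0 < 1 + ⟪ξ, ψ j⟫ := fun j =>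
    (hξS j).lt_of_ne' (prod_ne_zero_iff.1 (zero_lt_one.trans_le hone).ne' j (mem_univ j))
  have hnhds : S ∈ nhds ξ := by
    have hcont (j : ι) : ContinuousAt (fun η : E => 1 + ⟪η, ψ j⟫) ξ := by fun_prop
    filter_upwards [Filter.eventually_all.2 fun j => (hcont j).eventually_const_lt (hpos j)]
      with η hη j using (hη j).le
  exact ⟨ξ, hpos, sum_inv_smul_eq_zero_of_isLocalMax hpos (hmax.isLocalMax hnhds)⟩

end

/-- If the zero vector is an interior point of the convex hull of
`{ψ 1, …, ψ m} ⊆ ℝ^k`, then the Lagrange multiplier equation of the empirical likelihood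
maximization has a solution: there is `ξ ∈ ℝ^k` with `1 + ⟪ξ, ψ j⟫ > 0` for all `j` and
`∑ j, (1 + ⟪ξ, ψ j⟫)⁻¹ • ψ j = 0`. -/
theorem EL_lagrange_exists (k m : ℕ)
    (ψ : Fin m → EuclideanSpace ℝ (Fin k))
    (h0 : (0 : EuclideanSpace ℝ (Fin k)) ∈ interior (convexHull ℝ (Set.range ψ))) :
    ∃ ξ : EuclideanSpace ℝ (Fin k),
      (∀ j, 0 < 1 + ⟪ξ, ψ j⟫) ∧ ∑ j, (1 + ⟪ξ, ψ j⟫)⁻¹ • ψ j = 0 :=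
  exists_lagrange_multiplier_of_zero_mem_interior_convexHull h0
end

section
/- Let ψ_1, …, ψ_n be vectors in ℝ^k with n ≥ 1, let ψ̄ = (1/n)∑_{j=1}^n ψ_j, let ψ* = max_{1 ≤ j ≤ n} ‖ψ_j‖, let 0 ≤ a ≤ n, and set ψ_{n+1} = −a·ψ̄. Let θ ∈ ℝ^k with ‖θ‖ = 1 and ρ ≥ 0, and assume 1 + ρ⟨θ, ψ_j⟩ > 0 for all j = 1, …, n+1 and ∑_{j=1}^{n+1} ⟨θ, ψ_j⟩/(1 + ρ⟨θ, ψ_j⟩) = 0. Then (1 − a/n)·⟨θ, ψ̄⟩ ≥ (ρ/(1 + ρψ*)) · (1/n)∑_{j=1}^n ⟨θ, ψ_j⟩². -/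
open Finset RealInnerProductSpace

/-- The identity `x / (1 + ρ x) = x - ρ x² / (1 + ρ x)` bounds each summand, since
`1 + ρ x ≤ 1 + ρ M` when `x ≤ M`. -/
lemma div_one_add_mul_le {ρ x M : ℝ} (hρ : 0 ≤ ρ) (hx : 0 < 1 + ρ * x) (hM : x ≤ M) :
    x / (1 + ρ * x) ≤ x - ρ / (1 + ρ * M) * x ^ 2 := by
  have hle : ρ * x ^ 2 / (1 + ρ * M) ≤ ρ * x ^ 2 / (1 + ρ * x) := by gcongr
  have hid : x / (1 + ρ * x) = x - ρ * x ^ 2 / (1 + ρ * x) := by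
    rw [eq_sub_iff_add_eq, ← add_div, div_eq_iff hx.ne']
    ring
  rw [hid, div_mul_eq_mul_div]
  linarith

/-- The function `x ↦ x / (1 + ρ x)` lies below the identity where `1 + ρ x > 0`. -/
lemma div_one_add_mul_le_self {ρ x : ℝ} (hρ : 0 ≤ ρ) (hx : 0 < 1 + ρ * x) :
    x / (1 + ρ * x) ≤ x := by
  rw [div_le_iff₀ hx]
  nlinarith [mul_nonneg hρ (sq_nonneg x)]

/-- With the pseudo-observation `ψ (n+1) = -a • ψ̄` appended (`0 ≤ a ≤ n`),
`ψ* = max_{1 ≤ j ≤ n} ‖ψ j‖`, `‖θ‖ = 1`, `ρ ≥ 0`, if `1 + ρ ⟪θ, ψ j⟫ > 0` for all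
`j = 1, …, n+1` and `∑_{j=1}^{n+1} ⟪θ, ψ j⟫ / (1 + ρ ⟪θ, ψ j⟫) = 0`, then
`(1 - a/n) ⟪θ, ψ̄⟫ ≥ (ρ / (1 + ρ ψ*)) · (1/n) ∑_{j=1}^n ⟪θ, ψ j⟫²`. -/
theorem adjusted_EL_key_inequality (k n : ℕ) (hn : 0 < n)
    (ψ : Fin n → EuclideanSpace ℝ (Fin k)) (a : ℝ) (ha0 : 0 ≤ a) (han : a ≤ n)
    (ψbar : EuclideanSpace ℝ (Fin k)) (hbar : ψbar = (n : ℝ)⁻¹ • ∑ j, ψ j)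
    (ψext : Fin (n + 1) → EuclideanSpace ℝ (Fin k))
    (hext : ψext = Fin.snoc ψ (-(a • ψbar)))
    (ψstar : ℝ) (hstar : IsGreatest (Set.range fun j => ‖ψ j‖) ψstar)
    (θ : EuclideanSpace ℝ (Fin k)) (hθ : ‖θ‖ = 1) (ρ : ℝ) (hρ : 0 ≤ ρ)
    (hpos : ∀ j, 0 < 1 + ρ * ⟪θ, ψext j⟫)
    (heq : ∑ j, ⟪θ, ψext j⟫ / (1 + ρ * ⟪θ, ψext j⟫) = 0) :
    (ρ / (1 + ρ * ψstar)) * ((n : ℝ)⁻¹ * ∑ j, ⟪θ, ψ j⟫ ^ 2)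
      ≤ (1 - a / n) * ⟪θ, ψbar⟫ := by
  have hn' : (0 : ℝ) < n := by exact_mod_cast hn
  subst hext
  have hposj : ∀ j, 0 < 1 + ρ * ⟪θ, ψ j⟫ := fun j => by simpa using hpos j.castSucc
  have hposlast : 0 < 1 + ρ * ⟪θ, -(a • ψbar)⟫ := by
    simpa only [Fin.snoc_last] using hpos (Fin.last n)
  rw [Fin.sum_univ_castSucc] at heq
  simp only [Fin.snoc_castSucc, Fin.snoc_last] at heq
  have hM : ∀ j, ⟪θ, ψ j⟫ ≤ ψstar := fun j =>
    calc ⟪θ, ψ j⟫ ≤ ‖θ‖ * ‖ψ j‖ := real_inner_le_norm _ _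
      _ = ‖ψ j‖ := by rw [hθ, one_mul]
      _ ≤ ψstar := hstar.2 ⟨j, rfl⟩
  have hsum : ∑ j, ⟪θ, ψ j⟫ = n * ⟪θ, ψbar⟫ := by
    rw [hbar, real_inner_smul_right, inner_sum, mul_inv_cancel_left₀ hn'.ne']
  have hfirst := Finset.sum_le_sum fun j (_ : j ∈ Finset.univ) =>
    div_one_add_mul_le hρ (hposj j) (hM j)
  rw [Finset.sum_sub_distrib, ← Finset.mul_sum, hsum] at hfirst
  have hlast := div_one_add_mul_le_self hρ hposlast
  have hinner : ⟪θ, -(a • ψbar)⟫ = -(a * ⟪θ, ψbar⟫) := by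
    rw [inner_neg_right, real_inner_smul_right]
  have hmain : ρ / (1 + ρ * ψstar) * ∑ j, ⟪θ, ψ j⟫ ^ 2 ≤ (n - a) * ⟪θ, ψbar⟫ := by
    linarith
  calc ρ / (1 + ρ * ψstar) * ((n : ℝ)⁻¹ * ∑ j, ⟪θ, ψ j⟫ ^ 2)
      = (n : ℝ)⁻¹ * (ρ / (1 + ρ * ψstar) * ∑ j, ⟪θ, ψ j⟫ ^ 2) := by ring
    _ ≤ (n : ℝ)⁻¹ * ((n - a) * ⟪θ, ψbar⟫) := by gcongr
    _ = (1 - a / n) * ⟪θ, ψbar⟫ := by field_simp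
end
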